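/- Let q ≥ 2 be a prime power and m ≥ 2. Then δ₂ = (q-1)·q^(m-1) - q^⌊(m-1)/2⌋ - 1 is the second largest q-cyclotomic coset leader modulo q^m - 1; that is, δ₂ is a coset leader, and the only coset leader strictly between δ₂ and q^m - 1 is (q-1)·q^(m-1) - 1. -/

import Mathlib

/-- The q-cyclotomic coset of `a` modulo `N`. -/
def qCoset (q N a : ℕ) : Set ℕ := {b | ∃ j : ℕ, b = a * q ^ j % N}

/-- The coset leader: the smallest element of the q-cyclotomic coset of `a` modulo `N`. -/
noncomputable def cosetLeader (q N a : ℕ) : ℕ := sInf (qCoset q N a)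

/-- `a` is a coset leader modulo `N` if it is the minimum of its own coset. -/
def IsCosetLeader (q N a : ℕ) : Prop := a = cosetLeader q N a

theorem leader_le {q N c : ℕ} (h : IsCosetLeader q N c) (j : ℕ) : c ≤ c * q ^ j % N := by
  unfold IsCosetLeader cosetLeader at h
  conv_lhs => rw [h]
  exact Nat.sInf_le ⟨j, rfl⟩

theorem leader_of {q N c : ℕ} (hc : c < N) (h : ∀ j, c ≤ c * q ^ j % N) :
    IsCosetLeader q N c := by
  unfold IsCosetLeader cosetLeader
  apply le_antisymm
  · apply le_csInf
    · exact ⟨_, 0, rfl⟩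
    · rintro b ⟨j, rfl⟩
      exact h j
  · exact Nat.sInf_le ⟨0, by simp [Nat.mod_eq_of_lt hc]⟩

theorem compl_mod {N c x y k : ℕ} (hcx : c + x = N) (hy : 0 < y) (hyN : y ≤ N)
    (h : x * k ≡ y [MOD N]) : c * k % N = N - y := by
  have h1 : c * k ≡ N - y [MOD N] := by
    apply Nat.ModEq.add_right_cancel h
    have e1 : c * k + x * k = N * k := by rw [← hcx]; ring
    have e2 : N - y + y = N := by omega
    rw [e1, e2]
    simp [Nat.ModEq]
  rw [h1, Nat.mod_eq_of_lt (by omega)]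

theorem pow_m_modEq (q m : ℕ) (hq : 2 ≤ q) : q ^ m ≡ 1 [MOD (q ^ m - 1)] := by
  have : 1 ≤ q ^ m := Nat.one_le_pow _ _ (by omega)
  exact ((Nat.modEq_iff_dvd' this).2 dvd_rfl).symm

theorem pow_add_modEq (q m a b : ℕ) (hq : 2 ≤ q) (e : a = m + b) :
    q ^ a ≡ q ^ b [MOD (q ^ m - 1)] := by
  subst e
  rw [pow_add]
  simpa using (pow_m_modEq q m hq).mul_right (q ^ b)

theorem pow_mod_modEq (q m j : ℕ) (hq : 2 ≤ q) :
    q ^ j ≡ q ^ (j % m) [MOD (q ^ m - 1)] := by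
  conv_lhs => rw [← Nat.mod_add_div j m]
  rw [pow_add, pow_mul]
  simpa using ((pow_m_modEq q m hq).pow (j / m)).mul_left (q ^ (j % m))

/-- Every rotation of `q^(m-1) + q^h` is at most itself. -/
theorem rot_le (q m h : ℕ) (hq : 2 ≤ q) (hm : 2 ≤ m) (h1 : m ≤ 2 * h + 2) (h2 : h + 2 ≤ m)
    (j : ℕ) : ∃ y, 0 < y ∧ y ≤ q ^ (m - 1) + q ^ h ∧
      (q ^ (m - 1) + q ^ h) * q ^ j ≡ y [MOD (q ^ m - 1)] := by
  have hpos : ∀ a, 0 < q ^ a := fun a => Nat.pow_pos (by omega)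
  have hmono : ∀ a b, a ≤ b → q ^ a ≤ q ^ b := fun a b hab => Nat.pow_le_pow_right (by omega) hab
  have hk : j % m < m := Nat.mod_lt _ (by omega)
  have hred := (pow_mod_modEq q m j hq).mul_left (q ^ (m - 1) + q ^ h)
  generalize j % m = k at hk hred
  have htop : 2 * q ^ (m - 2) ≤ q ^ (m - 1) := by
    have : m - 1 = m - 2 + 1 := by omega
    rw [this, pow_succ, mul_comm]
    exact Nat.mul_le_mul_left _ hq
  rcases Nat.eq_zero_or_pos k with rfl | hk0
  · exact ⟨_, by have := hpos h; omega, le_rfl, by simpa using hred⟩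
  · have e1 : q ^ (m - 1) * q ^ k ≡ q ^ (k - 1) [MOD (q ^ m - 1)] := by
      rw [← pow_add]; exact pow_add_modEq q m _ _ hq (by omega)
    rw [add_mul (q ^ (m - 1)) (q ^ h) (q ^ k)] at hred
    rcases lt_or_ge (h + k) m with hlt | hge
    · refine ⟨q ^ (k - 1) + q ^ (h + k), by have := hpos (k-1); omega, ?_, ?_⟩
      · rcases Nat.lt_or_ge (h + k) (m - 1) with h3 | h3
        · have := hmono (k - 1) (m - 2) (by omega)
          have := hmono (h + k) (m - 2) (by omega)
          omega
        · have : h + k = m - 1 := by omega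
          rw [this]
          have := hmono (k - 1) h (by omega)
          omega
      · refine hred.trans (e1.add ?_)
        rw [← pow_add]
    · refine ⟨q ^ (k - 1) + q ^ (h + k - m), by have := hpos (k-1); omega, ?_, ?_⟩
      · have := hmono (k - 1) (m - 2) (by omega)
        have := hmono (h + k - m) (m - 2) (by omega)
        omega
      · refine hred.trans (e1.add ?_)
        rw [← pow_add]
        exact pow_add_modEq q m _ _ hq (by omega)

/-- An element below `q^(m-1) + q^h` other than `q^(m-1)` has a larger rotation. -/
theorem rot_gt (q m h x : ℕ) (hq : 2 ≤ q) (hm : 2 ≤ m) (h1 : 2 * h + 1 ≤ m) (h2 : h + 2 ≤ m)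
    (hx0 : 0 < x) (hx : x < q ^ (m - 1) + q ^ h) (hne : x ≠ q ^ (m - 1)) :
    ∃ j y, x < y ∧ y ≤ q ^ m - 1 ∧ x * q ^ j ≡ y [MOD (q ^ m - 1)] := by
  have hmono : ∀ a b, a ≤ b → q ^ a ≤ q ^ b := fun a b hab => Nat.pow_le_pow_right (by omega) hab
  have hqm : q ^ m = q * q ^ (m - 1) := by
    rw [← pow_succ']; congr 1; omega
  rcases Nat.lt_or_ge x (q ^ (m - 1)) with hlt | hge
  · refine ⟨1, x * q, by nlinarith, ?_, by simp [Nat.ModEq]⟩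
    have : (x + 1) * q ≤ q ^ (m - 1) * q := Nat.mul_le_mul_right _ hlt
    have : q ^ m = q ^ (m - 1) * q := by rw [hqm, mul_comm]
    have : (x + 1) * q = x * q + q := by ring
    omega
  · obtain ⟨r, rfl⟩ := Nat.exists_eq_add_of_le hge
    have hr0 : r ≠ 0 := by rintro rfl; simp at hne
    have hrh : r < q ^ h := by omega
    set l := Nat.log q r with hl
    have hl1 : q ^ l ≤ r := Nat.pow_log_le_self q hr0
    have hl2 : r < q ^ (l + 1) := Nat.lt_pow_succ_log_self (by omega) r
    have hlh : l < h := by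
      by_contra hcon
      have := hmono h l (by omega)
      omega
    obtain ⟨j, hj⟩ : ∃ j, m - 1 - l = j + 1 := ⟨m - 1 - l - 1, by omega⟩
    have hjh : h ≤ j := by omega
    have hj1 : 1 ≤ j := by omega
    refine ⟨j + 1, q ^ j + r * q ^ (j + 1), ?_, ?_, ?_⟩
    · have : q ^ l * q ^ (j + 1) ≤ r * q ^ (j + 1) := Nat.mul_le_mul_right _ hl1
      rw [← pow_add, show l + (j + 1) = m - 1 by omega] at this
      have := hmono h j hjh
      omega
    · have : (r + 1) * q ^ (j + 1) ≤ q ^ (l + 1) * q ^ (j + 1) := Nat.mul_le_mul_right _ hl2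
      rw [← pow_add, show l + 1 + (j + 1) = m by omega, add_mul, one_mul] at this
      have h3 : q ^ (j + 1) = q ^ j * q := pow_succ _ _
      have h4 : q ^ j * 2 ≤ q ^ j * q := Nat.mul_le_mul_left _ hq
      have h5 := hmono 0 j (by omega)
      rw [pow_zero] at h5
      omega
    · rw [add_mul]
      refine Nat.ModEq.add ?_ rfl
      rw [← pow_add]
      exact pow_add_modEq q m _ _ hq (by omega)

theorem stmt_3 (q m : ℕ) (hq : IsPrimePow q) (hm : 2 ≤ m) :
    IsCosetLeader q (q ^ m - 1) ((q - 1) * q ^ (m - 1) - q ^ ((m - 1) / 2) - 1) ∧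
    ∀ c : ℕ, (q - 1) * q ^ (m - 1) - q ^ ((m - 1) / 2) - 1 < c → c < q ^ m - 1 →
      IsCosetLeader q (q ^ m - 1) c → c = (q - 1) * q ^ (m - 1) - 1 := by
  have hq2 : 2 ≤ q := hq.two_le
  obtain ⟨h, hh⟩ : ∃ h, h = (m - 1) / 2 := ⟨_, rfl⟩
  rw [← hh]
  have hqm : q ^ m = (q - 1) * q ^ (m - 1) + q ^ (m - 1) := by
    have : q ^ m = q ^ (m - 1) * q := by rw [← pow_succ]; congr 1; omega
    obtain ⟨p, rfl⟩ : ∃ p, q = p + 1 := ⟨q - 1, by omega⟩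
    rw [this, Nat.add_sub_cancel]; ring
  have hA : q ^ (m - 1) ≤ (q - 1) * q ^ (m - 1) := Nat.le_mul_of_pos_left _ (by omega)
  have hB : q ^ h < q ^ (m - 1) := Nat.pow_lt_pow_right (by omega) (by omega)
  have hC : 0 < q ^ h := Nat.pow_pos (by omega)
  constructor
  · apply leader_of (by omega)
    intro j
    obtain ⟨y, hy0, hyx, hy⟩ := rot_le q m h hq2 hm (by omega) (by omega) j
    rw [compl_mod (x := q ^ (m - 1) + q ^ h) (by omega) hy0 (by omega) hy]
    omega
  · intro c hc1 hc2 hlead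
    by_contra hne
    obtain ⟨j, y, hxy, hyN, hy⟩ := rot_gt q m h (q ^ m - 1 - c) hq2 hm (by omega) (by omega)
      (by omega) (by omega) (by omega)
    have := leader_le hlead j
    rw [compl_mod (x := q ^ m - 1 - c) (by omega) (by omega) hyN hy] at this
    omega
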